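/- arXiv:1308.6681 — 2 statements merged into one kernel-verified Lean document; each statement's English description precedes it below -/
import Mathlib

section
/- Let 𝔥_{n,m} be the Heisenberg Lie superalgebra with even center, and let H_{n,m}^q = Λ̄^q V where V is the span of the dual basis vectors e₁,…,e_{2n}, o₁,…,o_m (excluding z*). Then H_{n,m}^q equals the space Z^q(𝔥_{n,m}) of q-cocycles with trivial coefficients, for every integer q. -/
noncomputable section

open TensorAlgebra

variable (F : Type) [Field F]

/-- The defining relations of the super-exterior algebra of the superspace `M₀ × M₁`
(`M₀` even, `M₁` odd): `u ⊗ v + (-1)^{|u||v|} v ⊗ u = 0`. -/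
inductive SRel (M₀ M₁ : Type) [AddCommGroup M₀] [Module F M₀] [AddCommGroup M₁] [Module F M₁] :
    TensorAlgebra F (M₀ × M₁) → TensorAlgebra F (M₀ × M₁) → Prop
  | ee (u v : M₀) : SRel M₀ M₁ (ι F (u, (0 : M₁)) * ι F (v, (0 : M₁)))
      (-(ι F (v, (0 : M₁)) * ι F (u, (0 : M₁))))
  | eo (u : M₀) (v : M₁) : SRel M₀ M₁ (ι F (u, (0 : M₁)) * ι F ((0 : M₀), v))
      (-(ι F ((0 : M₀), v) * ι F (u, (0 : M₁))))
  | oo (u v : M₁) : SRel M₀ M₁ (ι F ((0 : M₀), u) * ι F ((0 : M₀), v))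
      (ι F ((0 : M₀), v) * ι F ((0 : M₀), u))

variable (M₀ M₁ : Type) [AddCommGroup M₀] [Module F M₀] [AddCommGroup M₁] [Module F M₁]

/-- The super-exterior algebra `Λ̄(M₀ ⊕ M₁)`. -/
abbrev SExt : Type := RingQuot (SRel F M₀ M₁)

/-- The canonical image of an even vector. -/
def genE (u : M₀) : SExt F M₀ M₁ := RingQuot.mkAlgHom F (SRel F M₀ M₁) (ι F (u, (0 : M₁)))

/-- The canonical image of an odd vector. -/
def genO (v : M₁) : SExt F M₀ M₁ := RingQuot.mkAlgHom F (SRel F M₀ M₁) (ι F ((0 : M₀), v))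

/-- The monomial associated with a list of (even or odd) vectors. -/
def mon (l : List (M₀ ⊕ M₁)) : SExt F M₀ M₁ :=
  (l.map (Sum.elim (genE F M₀ M₁) (genO F M₀ M₁))).prod

/-- The `ℤ`-degree-`q` component `Λ̄^q` of the super-exterior algebra. -/
def sdeg (q : ℕ) : Submodule F (SExt F M₀ M₁) :=
  Submodule.span F {x | ∃ l : List (M₀ ⊕ M₁), l.length = q ∧ x = mon F M₀ M₁ l}

/-- The `ℤ₂`-homogeneous component of parity `ε` of the super-exterior algebra. -/
def sparity (ε : Bool) : Submodule F (SExt F M₀ M₁) :=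
  Submodule.span F {x | ∃ l : List (M₀ ⊕ M₁),
    l.countP Sum.isRight % 2 = (if ε then 1 else 0) ∧ x = mon F M₀ M₁ l}

/-- `D` satisfies the Leibniz rule of an exterior superderivation of
`ℤ×ℤ₂`-degree `(1, 0̄)`:  `D(μ∧ν) = Dμ∧ν + (-1)^‖μ‖ μ∧Dν`. -/
def IsLeib (D : SExt F M₀ M₁ →ₗ[F] SExt F M₀ M₁) : Prop :=
  ∀ (q : ℕ) (x : SExt F M₀ M₁), x ∈ sdeg F M₀ M₁ q → ∀ y : SExt F M₀ M₁,
    D (x * y) = D x * y + ((-1 : F) ^ q) • (x * D y)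

/-- `D` raises the `ℤ`-degree by one. -/
def RaisesDeg (D : SExt F M₀ M₁ →ₗ[F] SExt F M₀ M₁) : Prop :=
  ∀ (q : ℕ) (x : SExt F M₀ M₁), x ∈ sdeg F M₀ M₁ q → D x ∈ sdeg F M₀ M₁ (q + 1)

/-- `D` has `ℤ₂`-degree `0̄`. -/
def KeepsParity (D : SExt F M₀ M₁ →ₗ[F] SExt F M₀ M₁) : Prop :=
  ∀ (ε : Bool) (x : SExt F M₀ M₁), x ∈ sparity F M₀ M₁ ε → D x ∈ sparity F M₀ M₁ ε

open Module

variable (n m : ℕ)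

/-- The even part of 𝔥_{n,m}: the span of x₁,…,x_{2n} and the central z (last coordinate). -/
abbrev HV₀ : Type := Fin (2 * n + 1) → F

/-- The odd part of 𝔥_{n,m}: the span of y₁,…,y_m. -/
abbrev HV₁ : Type := Fin m → F

/-- The bracket of the Heisenberg Lie superalgebra `𝔥_{n,m}` with even center:
`[x_i, x_{n+i}] = z`, `[y_j, y_j] = z`. -/
def hBr (a b : HV₀ F n × HV₁ F m) : HV₀ F n × HV₁ F m :=
  (Pi.single (Fin.last (2 * n))
    ((∑ i : Fin n,
        (a.1 ⟨i.val, by have := i.isLt; omega⟩ * b.1 ⟨n + i.val, by have := i.isLt; omega⟩ -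
          a.1 ⟨n + i.val, by have := i.isLt; omega⟩ * b.1 ⟨i.val, by have := i.isLt; omega⟩)) +
      ∑ j : Fin m, a.2 j * b.2 j), 0)

/-- The cochain algebra `Λ̄ 𝔥_{n,m}*`. -/
abbrev HC : Type := SExt F (Dual F (HV₀ F n)) (Dual F (HV₁ F m))

/-- The dual basis vector `e_i` (for `i < 2n`) resp. `z*` (for `i = 2n`). -/
def hE (i : Fin (2 * n + 1)) : HC F n m :=
  genE F (Dual F (HV₀ F n)) (Dual F (HV₁ F m)) (LinearMap.proj i)

/-- The dual basis vector `o_j`. -/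
def hO (j : Fin m) : HC F n m :=
  genO F (Dual F (HV₀ F n)) (Dual F (HV₁ F m)) (LinearMap.proj j)

/-- `∑ e_{n+i} ∧ e_i − (1/2) ∑ o_j ∧ o_j`, the claimed value of `d z*`. -/
def hOmega : HC F n m :=
  (∑ i : Fin n, hE F n m ⟨n + i.val, by have := i.isLt; omega⟩ *
      hE F n m ⟨i.val, by have := i.isLt; omega⟩) -
    (2 : F)⁻¹ • ∑ j : Fin m, hO F n m j * hO F n m j

section
variable [CharZero F] (n m : ℕ)

/-- The subspace `H_{n,m}^q ⊂ Λ̄^q 𝔥*`: the degree-`q` part of the super-exterior algebra on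
the span of the dual vectors `e₁,…,e_{2n}, o₁,…,o_m` (the functionals vanishing on `z`). -/
def Hnm (q : ℕ) : Submodule F (HC F n m) :=
  Submodule.span F {x | ∃ l : List (Dual F (HV₀ F n) ⊕ Dual F (HV₁ F m)),
    l.length = q ∧
    (∀ g : Dual F (HV₀ F n), Sum.inl g ∈ l → g (Pi.single (Fin.last (2 * n)) 1) = 0) ∧
    x = mon F (Dual F (HV₀ F n)) (Dual F (HV₁ F m)) l}

variable (D : HC F n m →ₗ[F] HC F n m)

/-- `D` is the differential of the cochain complex of `𝔥_{n,m}`: the degree-one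
superderivation with `D e_i = 0`, `D o_j = 0` and `D z* = ∑ e_{n+i}∧e_i − ½∑ o_j∧o_j`
(equivalently, `D f = f(z) • Ω` for every even functional `f`). -/
def IsDiffNM : Prop :=
  RaisesDeg F (Dual F (HV₀ F n)) (Dual F (HV₁ F m)) D ∧
  IsLeib F (Dual F (HV₀ F n)) (Dual F (HV₁ F m)) D ∧
  (∀ f : Dual F (HV₀ F n),
    D (genE F (Dual F (HV₀ F n)) (Dual F (HV₁ F m)) f) =
      f (Pi.single (Fin.last (2 * n)) 1) • hOmega F n m) ∧
  (∀ h : Dual F (HV₁ F m), D (genO F (Dual F (HV₀ F n)) (Dual F (HV₁ F m)) h) = 0)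

/-- The space of `q`-cocycles. -/
def Znm (q : ℕ) : Submodule F (HC F n m) :=
  sdeg F (Dual F (HV₀ F n)) (Dual F (HV₁ F m)) q ⊓ LinearMap.ker D

/-- The space of `q`-coboundaries. -/
def Bnm (q : ℕ) : Submodule F (HC F n m) :=
  Submodule.map D (sdeg F (Dual F (HV₀ F n)) (Dual F (HV₁ F m)) (q - 1))

end

section Helpers

theorem sx_neg_mul (x y : SExt F M₀ M₁) : -x * y = -(x * y) := neg_mul x y

theorem sx_mul_neg (x y : SExt F M₀ M₁) : x * -y = -(x * y) := mul_neg x y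

theorem genE_add (u v : M₀) : genE F M₀ M₁ (u + v) = genE F M₀ M₁ u + genE F M₀ M₁ v := by
  unfold genE
  rw [← map_add, ← map_add]
  simp

theorem genE_smul (c : F) (u : M₀) : genE F M₀ M₁ (c • u) = c • genE F M₀ M₁ u := by
  unfold genE
  rw [← map_smul, ← map_smul]
  simp

theorem genO_add (u v : M₁) : genO F M₀ M₁ (u + v) = genO F M₀ M₁ u + genO F M₀ M₁ v := by
  unfold genO
  rw [← map_add, ← map_add]
  simp

theorem genO_smul (c : F) (u : M₁) : genO F M₀ M₁ (c • u) = c • genO F M₀ M₁ u := by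
  unfold genO
  rw [← map_smul, ← map_smul]
  simp

/-- `genE` as a linear map. -/
def genEL : M₀ →ₗ[F] SExt F M₀ M₁ where
  toFun := genE F M₀ M₁
  map_add' := genE_add F M₀ M₁
  map_smul' := genE_smul F M₀ M₁

/-- `genO` as a linear map. -/
def genOL : M₁ →ₗ[F] SExt F M₀ M₁ where
  toFun := genO F M₀ M₁
  map_add' := genO_add F M₀ M₁
  map_smul' := genO_smul F M₀ M₁

theorem gen_ee (u v : M₀) :
    genE F M₀ M₁ u * genE F M₀ M₁ v = -(genE F M₀ M₁ v * genE F M₀ M₁ u) := by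
  unfold genE
  have h := RingQuot.mkAlgHom_rel F (SRel.ee (F := F) (M₀ := M₀) (M₁ := M₁) u v)
  rw [map_mul, map_neg, map_mul] at h
  exact h

theorem gen_eo (u : M₀) (v : M₁) :
    genE F M₀ M₁ u * genO F M₀ M₁ v = -(genO F M₀ M₁ v * genE F M₀ M₁ u) := by
  unfold genE genO
  have h := RingQuot.mkAlgHom_rel F (SRel.eo (F := F) (M₀ := M₀) (M₁ := M₁) u v)
  rw [map_mul, map_neg, map_mul] at h
  exact h

theorem gen_oo (u v : M₁) :
    genO F M₀ M₁ u * genO F M₀ M₁ v = genO F M₀ M₁ v * genO F M₀ M₁ u := by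
  unfold genO
  have h := RingQuot.mkAlgHom_rel F (SRel.oo (F := F) (M₀ := M₀) (M₁ := M₁) u v)
  rw [map_mul, map_mul] at h
  exact h

theorem gen_sq [CharZero F] (u : M₀) : genE F M₀ M₁ u * genE F M₀ M₁ u = 0 := by
  have h := gen_ee F M₀ M₁ u u
  have h2 : (2 : F) • (genE F M₀ M₁ u * genE F M₀ M₁ u) = 0 := by
    rw [two_smul]
    nth_rewrite 1 [h]
    simp
  exact (smul_eq_zero.mp h2).resolve_left two_ne_zero

/-- Induction principle: the algebra is generated by the generators. -/
theorem sext_induction {P : SExt F M₀ M₁ → Prop}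
    (hc : ∀ r : F, P (algebraMap F _ r)) (hE : ∀ u, P (genE F M₀ M₁ u))
    (hO : ∀ u, P (genO F M₀ M₁ u)) (hadd : ∀ a b, P a → P b → P (a + b))
    (hmul : ∀ a b, P a → P b → P (a * b)) (x : SExt F M₀ M₁) : P x := by
  obtain ⟨t, rfl⟩ := RingQuot.mkAlgHom_surjective F (SRel F M₀ M₁) x
  induction t using TensorAlgebra.induction with
  | algebraMap r => rw [AlgHom.commutes]; exact hc r
  | ι w =>
    have : ι F w = ι F (w.1, (0 : M₁)) + ι F ((0 : M₀), w.2) := by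
      rw [← map_add]; simp
    rw [this, map_add]
    exact hadd _ _ (hE w.1) (hO w.2)
  | mul a b ha hb => rw [map_mul]; exact hmul _ _ ha hb
  | add a b ha hb => rw [map_add]; exact hadd _ _ ha hb

/-- The polynomial attached to an odd functional. -/
def polyL : Dual F (Fin m → F) →ₗ[F] MvPolynomial (Fin m) F where
  toFun h := ∑ j, h (Pi.single j 1) • MvPolynomial.X j
  map_add' a b := by simp [add_smul, Finset.sum_add_distrib]
  map_smul' c a := by simp [mul_smul, Finset.smul_sum]

open scoped TensorProduct

/-- The model space. -/
abbrev Mdl : Type := ExteriorAlgebra F M₀ ⊗[F] MvPolynomial (Fin m) F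

/-- Grade involution. -/
def inv0 : ExteriorAlgebra F M₀ →ₐ[F] ExteriorAlgebra F M₀ :=
  ExteriorAlgebra.map (-LinearMap.id)

theorem inv0_ι (u : M₀) : inv0 F M₀ (ExteriorAlgebra.ι F u) = -ExteriorAlgebra.ι F u := by
  simp [inv0]

theorem inv0_inv0 (a : ExteriorAlgebra F M₀) : inv0 F M₀ (inv0 F M₀ a) = a := by
  have : (inv0 F M₀).comp (inv0 F M₀) = AlgHom.id F _ := by
    apply ExteriorAlgebra.hom_ext
    ext u
    simp [inv0_ι]
  exact DFunLike.congr_fun this a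

/-- Action of even vectors on the model. -/
def actE : M₀ →ₗ[F] Module.End F (Mdl F M₀ m) where
  toFun u := TensorProduct.map (LinearMap.mulLeft F (ExteriorAlgebra.ι F u)) LinearMap.id
  map_add' a b := by
    ext : 4
    simp [add_mul, TensorProduct.add_tmul]
  map_smul' c a := by
    ext : 4
    simp [TensorProduct.smul_tmul']

/-- Action of odd vectors on the model. -/
def actO : Dual F (Fin m → F) →ₗ[F] Module.End F (Mdl F M₀ m) where
  toFun h := TensorProduct.map (inv0 F M₀).toLinearMap (LinearMap.mulLeft F (polyL F m h))
  map_add' a b := by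
    refine TensorProduct.ext' fun x y => ?_
    simp [add_mul, TensorProduct.tmul_add]
  map_smul' c a := by
    refine TensorProduct.ext' fun x y => ?_
    simp

theorem actE_tmul (u : M₀) (a : ExteriorAlgebra F M₀) (p : MvPolynomial (Fin m) F) :
    actE F M₀ m u (a ⊗ₜ p) = (ExteriorAlgebra.ι F u * a) ⊗ₜ p := by
  simp [actE]

theorem actO_tmul (h : Dual F (Fin m → F)) (a : ExteriorAlgebra F M₀)
    (p : MvPolynomial (Fin m) F) :
    actO F M₀ m h (a ⊗ₜ p) = (inv0 F M₀ a) ⊗ₜ (polyL F m h * p) := by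
  simp [actO]

/-- The representation of the super-exterior algebra on the model. -/
def rep : SExt F M₀ (Dual F (Fin m → F)) →ₐ[F] Module.End F (Mdl F M₀ m) :=
  RingQuot.liftAlgHom F ⟨TensorAlgebra.lift F ((actE F M₀ m).coprod (actO F M₀ m)), by
    intro x y hxy
    cases hxy with
    | ee u v =>
      refine TensorProduct.ext' fun a p => ?_
      have h := eq_neg_of_add_eq_zero_left (ExteriorAlgebra.ι_add_mul_swap (R := F) u v)
      simp [actE_tmul, ← mul_assoc, h, TensorProduct.neg_tmul]
    | eo u v =>
      refine TensorProduct.ext' fun a p => ?_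
      simp [actE_tmul, actO_tmul, inv0_ι, TensorProduct.neg_tmul]
    | oo u v =>
      refine TensorProduct.ext' fun a p => ?_
      simp [actO_tmul, mul_left_comm]⟩

theorem rep_genE (u : M₀) : rep F M₀ m (genE F M₀ _ u) = actE F M₀ m u := by
  unfold rep genE
  rw [RingQuot.liftAlgHom_mkAlgHom_apply]
  simp

theorem rep_genO (u : Dual F (Fin m → F)) : rep F M₀ m (genO F M₀ _ u) = actO F M₀ m u := by
  unfold rep genO
  rw [RingQuot.liftAlgHom_mkAlgHom_apply]
  simp

/-- Polynomials in the odd generators. -/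
theorem exists_poly : ∃ f : MvPolynomial (Fin m) F →ₐ[F] SExt F M₀ (Dual F (Fin m → F)),
    ∀ j, f (MvPolynomial.X j) = genO F M₀ (Dual F (Fin m → F)) (LinearMap.proj j) := by
  let s : Set (SExt F M₀ (Dual F (Fin m → F))) :=
    Set.range (genO F M₀ (Dual F (Fin m → F)))
  letI : CommRing (Algebra.adjoin F s) := Algebra.adjoinCommRingOfComm F (s := s) (by
    rintro _ ⟨a, rfl⟩ _ ⟨b, rfl⟩
    exact gen_oo F _ _ a b)
  refine ⟨(Algebra.adjoin F s).val.comp (MvPolynomial.aeval (R := F)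
    (S₁ := Algebra.adjoin F s) (fun j => ⟨genO F M₀ _ (LinearMap.proj j),
      Algebra.subset_adjoin ⟨_, rfl⟩⟩)), fun j => ?_⟩
  simp

/-- The algebra map from polynomials. -/
def jP : MvPolynomial (Fin m) F →ₐ[F] SExt F M₀ (Dual F (Fin m → F)) :=
  (exists_poly F M₀ m).choose

theorem jP_polyL (h : Dual F (Fin m → F)) :
    jP F M₀ m (polyL F m h) = genO F M₀ _ h := by
  have hX : ∀ j, jP F M₀ m (MvPolynomial.X j) = genOL F M₀ (Dual F (Fin m → F))
    (LinearMap.proj j) := (exists_poly F M₀ m).choose_spec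
  have hh : h = ∑ j, h (Pi.single j 1) • (LinearMap.proj j : Dual F (Fin m → F)) := by
    refine LinearMap.pi_ext' fun i => ?_
    ext
    simp [Pi.single_apply]
  show _ = genOL F M₀ _ h
  conv_rhs => rw [hh]
  simp [polyL, hX]

variable [CharZero F]

/-- The algebra map from the exterior algebra. -/
def iE : ExteriorAlgebra F M₀ →ₐ[F] SExt F M₀ M₁ :=
  ExteriorAlgebra.lift F ⟨genEL F M₀ M₁, gen_sq F M₀ M₁⟩

theorem iE_ι (u : M₀) : iE F M₀ M₁ (ExteriorAlgebra.ι F u) = genE F M₀ M₁ u := by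
  simp [iE, genEL]

theorem genO_iE (v : M₁) (a : ExteriorAlgebra F M₀) :
    genO F M₀ M₁ v * iE F M₀ M₁ a = iE F M₀ M₁ (inv0 F M₀ a) * genO F M₀ M₁ v := by
  induction a using ExteriorAlgebra.induction with
  | algebraMap r =>
    simp only [AlgHom.commutes]
    exact (Algebra.commutes r _).symm
  | ι u => rw [inv0_ι, map_neg, iE_ι, sx_neg_mul, gen_eo, neg_neg]
  | mul a b ha hb =>
    rw [map_mul, map_mul, map_mul, ← mul_assoc, ha, mul_assoc, hb, mul_assoc]
  | add a b ha hb => rw [map_add, map_add, map_add, mul_add, ha, hb, add_mul]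

/-- The map back from the model. -/
def psi : Mdl F M₀ m →ₗ[F] SExt F M₀ (Dual F (Fin m → F)) :=
  TensorProduct.lift ((LinearMap.mul F (SExt F M₀ (Dual F (Fin m → F)))).compl₁₂
    (iE F M₀ _).toLinearMap (jP F M₀ m).toLinearMap)

theorem psi_tmul (a : ExteriorAlgebra F M₀) (p : MvPolynomial (Fin m) F) :
    psi F M₀ m (a ⊗ₜ p) = iE F M₀ _ a * jP F M₀ m p := by
  simp [psi]

theorem psi_rep (x : SExt F M₀ (Dual F (Fin m → F))) :
    ∀ t, psi F M₀ m (rep F M₀ m x t) = x * psi F M₀ m t := by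
  induction x using sext_induction with
  | hc r => intro t; simp [Algebra.smul_def]
  | hE u =>
    intro t
    induction t using TensorProduct.induction_on with
    | zero => simp
    | tmul a p => rw [rep_genE, actE_tmul, psi_tmul, psi_tmul, map_mul, iE_ι, mul_assoc]
    | add a b ha hb => simp only [map_add, ha, hb, mul_add]
  | hO u =>
    intro t
    induction t using TensorProduct.induction_on with
    | zero => simp
    | tmul a p =>
      rw [rep_genO, actO_tmul, psi_tmul, psi_tmul, map_mul, jP_polyL, ← mul_assoc, ← mul_assoc,
        genO_iE]
    | add a b ha hb => simp only [map_add, ha, hb, mul_add]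
  | hadd a b ha hb => intro t; simp [ha, hb, add_mul]
  | hmul a b ha hb => intro t; simp [ha, hb, mul_assoc]

theorem rep_inj (x : SExt F M₀ (Dual F (Fin m → F)))
    (h : rep F M₀ m x (1 ⊗ₜ 1) = 0) : x = 0 := by
  have := psi_rep F M₀ m x (1 ⊗ₜ 1)
  rw [h, psi_tmul] at this
  simpa using this.symm

/-- The sum of squares of odd generators is not a zero divisor. -/
theorem sq_regular (hm : 1 ≤ m) (b : SExt F M₀ (Dual F (Fin m → F)))
    (h : (∑ j : Fin m, genO F M₀ (Dual F (Fin m → F)) (LinearMap.proj j) *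
      genO F M₀ (Dual F (Fin m → F)) (LinearMap.proj j)) * b = 0) : b = 0 := by
  apply rep_inj
  set s : MvPolynomial (Fin m) F := ∑ j, MvPolynomial.X j * MvPolynomial.X j with hs
  have hs0 : s ≠ 0 := by
    intro h0
    have := congrArg (MvPolynomial.eval (fun _ => (1 : F))) h0
    simp [hs] at this
    omega
  have hpx : ∀ j : Fin m, polyL F m (LinearMap.proj j) = MvPolynomial.X j := by
    intro j
    simp [polyL, Pi.single_apply]
  have hact : ∀ t, rep F M₀ m (∑ j : Fin m, genO F M₀ (Dual F (Fin m → F)) (LinearMap.proj j) *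
      genO F M₀ (Dual F (Fin m → F)) (LinearMap.proj j)) t =
      (LinearMap.mulLeft F s).lTensor (ExteriorAlgebra F M₀) t := by
    intro t
    induction t using TensorProduct.induction_on with
    | zero => simp
    | tmul a p =>
      simp only [map_sum, map_mul, LinearMap.sum_apply, Module.End.mul_apply, rep_genO, actO_tmul,
        inv0_inv0, hpx, LinearMap.lTensor_tmul, LinearMap.mulLeft_apply, hs, Finset.sum_mul,
        TensorProduct.tmul_sum, mul_assoc]
    | add a b ha hb => rw [map_add, ha, hb, map_add]
  have hinj : Function.Injective ((LinearMap.mulLeft F s).lTensor (ExteriorAlgebra F M₀)) := by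
    apply Module.Flat.lTensor_preserves_injective_linearMap
    intro p q hpq
    exact mul_left_cancel₀ hs0 hpq
  apply hinj
  rw [← hact, ← Module.End.mul_apply, ← map_mul, h]
  simp

theorem gen_ee_comm (a b c d : M₀) :
    Commute (genE F M₀ M₁ a * genE F M₀ M₁ b) (genE F M₀ M₁ c * genE F M₀ M₁ d) := by
  have key : ∀ x : M₀, Commute (genE F M₀ M₁ a * genE F M₀ M₁ b) (genE F M₀ M₁ x) := by
    intro x
    show _ * _ = _ * _
    rw [mul_assoc, gen_ee F M₀ M₁ b x, sx_mul_neg, ← mul_assoc, gen_ee F M₀ M₁ a x, sx_neg_mul, neg_neg,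
      mul_assoc]
  exact (key c).mul_right (key d)

theorem gen_pair_sq (a b : M₀) : (genE F M₀ M₁ a * genE F M₀ M₁ b) ^ 2 = 0 := by
  rw [pow_two, mul_assoc, gen_ee F M₀ M₁ a b, sx_mul_neg, ← mul_assoc (genE F M₀ M₁ b),
    gen_sq, zero_mul]
  exact (congrArg _ neg_zero).trans (mul_zero _)

theorem gen_eo_comm (a b : M₀) (c d : M₁) :
    Commute (genE F M₀ M₁ a * genE F M₀ M₁ b) (genO F M₀ M₁ c * genO F M₀ M₁ d) := by
  have key : ∀ x : M₁, Commute (genE F M₀ M₁ a * genE F M₀ M₁ b) (genO F M₀ M₁ x) := by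
    intro x
    show _ * _ = _ * _
    rw [mul_assoc, gen_eo F M₀ M₁ b x, sx_mul_neg, ← mul_assoc, gen_eo F M₀ M₁ a x, sx_neg_mul, neg_neg,
      mul_assoc]
  exact (key c).mul_right (key d)

theorem omega_regular (hm : 1 ≤ m) (b : HC F n m) (h : hOmega F n m * b = 0) : b = 0 := by
  unfold hOmega at h
  set N : HC F n m := ∑ i : Fin n, hE F n m ⟨n + i.val, by have := i.isLt; omega⟩ *
      hE F n m ⟨i.val, by have := i.isLt; omega⟩ with hN
  set S : HC F n m := ∑ j : Fin m, hO F n m j * hO F n m j with hS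
  have hnil : IsNilpotent N := by
    apply Commute.isNilpotent_sum
    · intro i _
      refine ⟨2, ?_⟩
      exact gen_pair_sq F _ _ _ _
    · intro i j _ _
      exact gen_ee_comm F _ _ _ _ _ _
  have hcomm : Commute N S :=
    Commute.sum_left _ _ _ fun i _ => Commute.sum_right _ _ _ fun j _ => gen_eo_comm F _ _ _ _ _ _
  have hSb : S * b = ((2 : F) • N) * b := by
    rw [sub_mul, sub_eq_zero] at h
    rw [smul_mul_assoc, h, smul_mul_assoc, smul_smul, mul_inv_cancel₀ two_ne_zero, one_smul]
  have hc2 : Commute S ((2 : F) • N) := (hcomm.symm).smul_right 2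
  have hpow : ∀ k : ℕ, S ^ k * b = ((2 : F) • N) ^ k * b := by
    intro k
    induction k with
    | zero => simp
    | succ k ih =>
      rw [pow_succ', mul_assoc, ih, ← mul_assoc, (hc2.pow_right k).eq, mul_assoc, hSb,
        ← mul_assoc, ← pow_succ]
  have hreg : ∀ k : ℕ, S ^ k * b = 0 → b = 0 := by
    intro k
    induction k with
    | zero => simp
    | succ k ih =>
      intro hk
      rw [pow_succ', mul_assoc] at hk
      exact ih (sq_regular F _ m hm _ hk)
  obtain ⟨k, hk⟩ := hnil
  apply hreg k
  rw [hpow, smul_pow, hk]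
  simp

theorem mon_cons (g : M₀ ⊕ M₁) (l : List (M₀ ⊕ M₁)) :
    mon F M₀ M₁ (g :: l) = Sum.elim (genE F M₀ M₁) (genO F M₀ M₁) g * mon F M₀ M₁ l := by
  simp [mon]

theorem genE_mem (g : M₀) : genE F M₀ M₁ g ∈ sdeg F M₀ M₁ 1 :=
  Submodule.subset_span ⟨[Sum.inl g], rfl, by simp [mon]⟩

theorem genO_mem (g : M₁) : genO F M₀ M₁ g ∈ sdeg F M₀ M₁ 1 :=
  Submodule.subset_span ⟨[Sum.inr g], rfl, by simp [mon]⟩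

theorem Hnm_le (D : HC F n m →ₗ[F] HC F n m) (hD : IsDiffNM F n m D) (q : ℕ) :
    Hnm F n m q ≤ Znm F n m D q := by
  obtain ⟨-, hL, hDe, hDo⟩ := hD
  refine Submodule.span_le.mpr ?_
  rintro x ⟨l, hl, hg, rfl⟩
  refine ⟨Submodule.subset_span ⟨l, hl, rfl⟩, ?_⟩
  clear hl
  show D _ = 0
  induction l with
  | nil =>
    have := hL 0 1 (Submodule.subset_span ⟨[], rfl, by simp [mon]⟩) 1
    simpa [mon] using this
  | cons g l ih =>
    have ih' := ih fun g' hg' => hg g' (List.mem_cons_of_mem _ hg')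
    rw [mon_cons]
    cases g with
    | inl g =>
      simp only [Sum.elim_inl]
      rw [hL 1 _ (genE_mem F _ _ g), ih', hDe, hg g (by simp)]
      simp
    | inr g =>
      simp only [Sum.elim_inr]
      rw [hL 1 _ (genO_mem F _ _ g), ih', hDo]
      simp

theorem Hnm_mulE (q : ℕ) (g : Dual F (HV₀ F n)) (hg : g (Pi.single (Fin.last (2 * n)) 1) = 0)
    (a : HC F n m) (ha : a ∈ Hnm F n m q) : genE F _ _ g * a ∈ Hnm F n m (q + 1) := by
  induction ha using Submodule.span_induction with
  | mem x hx =>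
    obtain ⟨l, hl, hl2, rfl⟩ := hx
    refine Submodule.subset_span ⟨Sum.inl g :: l, by simp [hl], ?_, by simp [mon_cons]⟩
    intro g' hg'
    rcases List.mem_cons.mp hg' with h | h
    · cases h; exact hg
    · exact hl2 g' h
  | zero => simp
  | add x y _ _ hx hy => rw [mul_add]; exact add_mem hx hy
  | smul c x _ hx => rw [mul_smul_comm]; exact Submodule.smul_mem _ _ hx

theorem Hnm_mulO (q : ℕ) (g : Dual F (HV₁ F m))
    (a : HC F n m) (ha : a ∈ Hnm F n m q) : genO F _ _ g * a ∈ Hnm F n m (q + 1) := by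
  induction ha using Submodule.span_induction with
  | mem x hx =>
    obtain ⟨l, hl, hl2, rfl⟩ := hx
    refine Submodule.subset_span ⟨Sum.inr g :: l, by simp [hl], ?_, by simp [mon_cons]⟩
    intro g' hg'
    rcases List.mem_cons.mp hg' with h | h
    · cases h
    · exact hl2 g' h
  | zero => simp
  | add x y _ _ hx hy => rw [mul_add]; exact add_mem hx hy
  | smul c x _ hx => rw [mul_smul_comm]; exact Submodule.smul_mem _ _ hx

theorem decomp_mon (D : HC F n m →ₗ[F] HC F n m) (hD : IsDiffNM F n m D)
    (l : List (Dual F (HV₀ F n) ⊕ Dual F (HV₁ F m))) :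
    ∃ a ∈ Hnm F n m l.length, ∃ b, D b = 0 ∧
      mon F _ _ l = a + hE F n m (Fin.last (2 * n)) * b := by
  have hD' := hD
  obtain ⟨-, hL, hDe, hDo⟩ := hD
  induction l with
  | nil => exact ⟨_, Submodule.subset_span ⟨[], rfl, by simp, rfl⟩, 0, by simp, by simp⟩
  | cons g l ih =>
    obtain ⟨a, ha, b, hb, hab⟩ := ih
    have hDa : D a = 0 := (Hnm_le F n m D hD' _ ha).2
    rw [mon_cons, hab]
    cases g with
    | inl g =>
      set c := g (Pi.single (Fin.last (2 * n)) 1) with hc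
      set z : Dual F (HV₀ F n) := LinearMap.proj (Fin.last (2 * n)) with hz
      set g' := g - c • z with hg'
      have hg0 : g' (Pi.single (Fin.last (2 * n)) 1) = 0 := by simp [hg', hz, hc]
      have hgg : g = g' + c • z := by simp [hg']
      refine ⟨_, Hnm_mulE F n m _ g' hg0 a ha, c • a - genE F _ _ g' * b, ?_, ?_⟩
      · rw [map_sub, map_smul, hDa, hL 1 _ (genE_mem F _ _ g'), hDe, hg0, hb]
        simp
      · simp only [Sum.elim_inl]
        rw [hgg, genE_add, genE_smul]
        show _ = _ + genE F _ _ z * _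
        show (_ : HC F n m) * (_ + genE F _ _ z * _) = _
        simp only [add_mul, mul_add, mul_sub, smul_mul_assoc, mul_smul_comm, ← mul_assoc,
          gen_sq, gen_ee F _ _ g' z, sx_neg_mul]
        simp
        abel
    | inr g =>
      refine ⟨_, Hnm_mulO F n m _ g a ha, - (genO F _ _ g * b), ?_, ?_⟩
      · rw [map_neg, hL 1 _ (genO_mem F _ _ g), hDo, hb]
        simp
      · simp only [Sum.elim_inr, hE, mul_add, sx_mul_neg, ← mul_assoc, gen_eo, sx_neg_mul, neg_neg]

theorem decomp (D : HC F n m →ₗ[F] HC F n m) (hD : IsDiffNM F n m D) (q : ℕ) (x : HC F n m)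
    (hx : x ∈ sdeg F (Dual F (HV₀ F n)) (Dual F (HV₁ F m)) q) :
    ∃ a ∈ Hnm F n m q, ∃ b, D b = 0 ∧ x = a + hE F n m (Fin.last (2 * n)) * b := by
  induction hx using Submodule.span_induction with
  | mem x hx =>
    obtain ⟨l, rfl, rfl⟩ := hx
    exact decomp_mon F n m D hD l
  | zero => exact ⟨0, zero_mem _, 0, by simp, by simp⟩
  | add x y _ _ hx hy =>
    obtain ⟨a, ha, b, hb, rfl⟩ := hx
    obtain ⟨a', ha', b', hb', rfl⟩ := hy
    exact ⟨a + a', add_mem ha ha', b + b', by simp [hb, hb'], by rw [mul_add]; abel⟩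
  | smul c x _ hx =>
    obtain ⟨a, ha, b, hb, rfl⟩ := hx
    exact ⟨c • a, Submodule.smul_mem _ _ ha, c • b, by simp [hb], by
      rw [smul_add, mul_smul_comm]⟩

end Helpers

theorem stmt4 [CharZero F] (n m : ℕ) (hn : 1 ≤ n) (hm : 1 ≤ m)
    (D : HC F n m →ₗ[F] HC F n m) (hD : IsDiffNM F n m D) (q : ℕ) :
    Hnm F n m q = Znm F n m D q := by
  refine le_antisymm (Hnm_le F n m D hD q) ?_
  rintro x ⟨hx, hx0⟩
  replace hx0 : D x = 0 := hx0
  obtain ⟨a, ha, b, hb, rfl⟩ := decomp F n m D hD q x hx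
  have hDa : D a = 0 := (Hnm_le F n m D hD _ ha).2
  have hz : D (hE F n m (Fin.last (2 * n)) * b) = hOmega F n m * b := by
    unfold hE
    rw [hD.2.1 1 _ (genE_mem F _ _ _), hD.2.2.1, hb]
    simp
  rw [map_add, hDa, zero_add, hz] at hx0
  rw [omega_regular F n m hm b hx0]
  simpa using ha
end
end

section
/- Let 𝔥_n be the Heisenberg Lie superalgebra with odd center over a field of characteristic zero, H_n = Λ̄V where V is spanned by e₁,…,e_n (even) and o₁,…,o_n (odd). Suppose α ∈ H_n^q satisfies α ∧ τ_{(n,l)} = 0, where τ_{(n,l)} = d((z*)^l) = l τ_{(n,1)} ∧ (z*)^{l−1} and τ_{(n,1)} = ∑_{i=1}^n o_i ∧ e_i. Then there exist β ∈ H_n^{q−2} and λ in the field such that α = β ∧ τ_{(n,1)} + δ_{q,n} λ e₁ ∧ ⋯ ∧ e_n. -/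
noncomputable section

open TensorAlgebra

variable (F : Type) [Field F]

variable (M₀ M₁ : Type) [AddCommGroup M₀] [Module F M₀] [AddCommGroup M₁] [Module F M₁]

open Module

variable (n : ℕ)

/-- The even part of `𝔥_n`: the span of `x₁,…,x_n`. -/
abbrev KV₀ : Type := Fin n → F

/-- The odd part of `𝔥_n`: the span of `y₁,…,y_n` and the central `z` (last coordinate). -/
abbrev KV₁ : Type := Fin (n + 1) → F

/-- The bracket of the Heisenberg Lie superalgebra `𝔥_n` with odd center: `[x_i, y_i] = z`. -/
def kBr (a b : KV₀ F n × KV₁ F n) : KV₀ F n × KV₁ F n :=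
  (0, Pi.single (Fin.last n)
    (∑ i : Fin n, (a.1 i * b.2 i.castSucc - b.1 i * a.2 i.castSucc)))

/-- The cochain algebra `Λ̄ 𝔥_n*`. -/
abbrev KC : Type := SExt F (Dual F (KV₀ F n)) (Dual F (KV₁ F n))

/-- The dual basis vector `e_i` (even). -/
def kE (i : Fin n) : KC F n :=
  genE F (Dual F (KV₀ F n)) (Dual F (KV₁ F n)) (LinearMap.proj i)

/-- The dual basis vector `o_j` (odd). -/
def kO (j : Fin n) : KC F n :=
  genO F (Dual F (KV₀ F n)) (Dual F (KV₁ F n)) (LinearMap.proj j.castSucc)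

/-- The dual `z*` of the odd center (odd). -/
def kZ : KC F n :=
  genO F (Dual F (KV₀ F n)) (Dual F (KV₁ F n)) (LinearMap.proj (Fin.last n))

/-- `τ_{(n,1)} = ∑ o_i ∧ e_i`. -/
def kTau : KC F n := ∑ i : Fin n, kO F n i * kE F n i

/-- `τ_{(n,l)} = l τ_{(n,1)} ∧ (z*)^{l−1}`. -/
def kTauL (l : ℕ) : KC F n := (l : F) • (kTau F n * kZ F n ^ (l - 1))

/-- `H_n^q`: the degree-`q` part of `Λ̄ V` for `V` the span of `e₁,…,e_n, o₁,…,o_n`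
(the dual vectors other than `z*`, i.e. odd functionals vanishing on `z`). -/
def Hn (q : ℕ) : Submodule F (KC F n) :=
  Submodule.span F {x | ∃ l : List (Dual F (KV₀ F n) ⊕ Dual F (KV₁ F n)),
    l.length = q ∧
    (∀ h : Dual F (KV₁ F n), Sum.inr h ∈ l → h (Pi.single (Fin.last n) 1) = 0) ∧
    x = mon F (Dual F (KV₀ F n)) (Dual F (KV₁ F n)) l}

/-- The top exterior monomial `e₁ ∧ ⋯ ∧ e_n`. -/
def kTop : KC F n :=
  mon F (Dual F (KV₀ F n)) (Dual F (KV₁ F n))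
    (List.ofFn fun i : Fin n => Sum.inl (LinearMap.proj i))

/-- `D` is the differential of the cochain complex of `𝔥_n`: the degree-one superderivation
with `D e_i = 0`, `D o_j = 0` and `D z* = τ_{(n,1)} = ∑ o_i ∧ e_i` (equivalently,
`D h = h(z) • τ` for every odd functional `h`). -/
def IsDiffN (D : KC F n →ₗ[F] KC F n) : Prop :=
  RaisesDeg F (Dual F (KV₀ F n)) (Dual F (KV₁ F n)) D ∧
  IsLeib F (Dual F (KV₀ F n)) (Dual F (KV₁ F n)) D ∧
  (∀ f : Dual F (KV₀ F n), D (genE F (Dual F (KV₀ F n)) (Dual F (KV₁ F n)) f) = 0) ∧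
  (∀ h : Dual F (KV₁ F n),
    D (genO F (Dual F (KV₀ F n)) (Dual F (KV₁ F n)) h) =
      h (Pi.single (Fin.last n) 1) • kTau F n)

/-- The space of `q`-cocycles of `𝔥_n`. -/
def Zn (D : KC F n →ₗ[F] KC F n) (q : ℕ) : Submodule F (KC F n) :=
  sdeg F (Dual F (KV₀ F n)) (Dual F (KV₁ F n)) q ⊓ LinearMap.ker D


/-- Abstract presentation of the super-exterior algebra together with dual bases. -/
structure SData (F M₀ M₁ A : Type) [Field F] [AddCommGroup M₀] [Module F M₀] [AddCommGroup M₁]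
    [Module F M₁] [Ring A] [Algebra F A] (n : ℕ) where
  gE : M₀ →ₗ[F] A
  gO : M₁ →ₗ[F] A
  ee : ∀ u v, gE u * gE v = -(gE v * gE u)
  eo : ∀ u v, gE u * gO v = -(gO v * gE u)
  oo : ∀ u v, gO u * gO v = gO v * gO u
  lift : ∀ (f : M₀ →ₗ[F] Module.End F (A × A)) (g : M₁ →ₗ[F] Module.End F (A × A)),
    (∀ u v, f u * f v = -(f v * f u)) → (∀ u v, f u * g v = -(g v * f u)) →
    (∀ u v, g u * g v = g v * g u) →
    ∃ Φ : A →ₐ[F] Module.End F (A × A), (∀ u, Φ (gE u) = f u) ∧ (∀ v, Φ (gO v) = g v)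
  adj : Algebra.adjoin F (Set.range gE ∪ Set.range gO) = ⊤
  φ : Fin n → M₀ →ₗ[F] F
  ψ : Fin n → M₁ →ₗ[F] F
  ζ : M₁ →ₗ[F] F
  e : Fin n → M₀
  o : Fin n → M₁
  z : M₁
  φe : ∀ i j, φ i (e j) = if i = j then 1 else 0
  ψo : ∀ i j, ψ i (o j) = if i = j then 1 else 0
  ζo : ∀ i, ζ (o i) = 0
  ζz : ζ z = 1
  sumE : ∀ u, ∑ i, φ i u • e i = u
  sumO : ∀ v, ζ v = 0 → ∑ i, ψ i v • o i = v

namespace SData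

variable {F M₀ M₁ A : Type} [Field F] [AddCommGroup M₀] [Module F M₀] [AddCommGroup M₁]
    [Module F M₁] [Ring A] [Algebra F A] {n : ℕ} (S : SData F M₀ M₁ A n)

/-- Lower triangular operators. -/
def tri (s : F) (g : M₀ →ₗ[F] A) (φ : M₀ →ₗ[F] F) : M₀ →ₗ[F] Module.End F (A × A) where
  toFun u :=
    { toFun := fun x => (g u * x.1, φ u • x.1 + s • (g u * x.2))
      map_add' := by
        intro x y
        refine Prod.ext ?_ ?_
        · simp [mul_add]
        · simp [mul_add]; abel
      map_smul' := by
        intro c x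
        refine Prod.ext ?_ ?_ <;> simp [smul_comm c] }
  map_add' := by
    intro a b
    refine LinearMap.ext fun x => Prod.ext ?_ ?_
    · simp [add_mul]
    · simp [add_mul, add_smul]; abel
  map_smul' := by
    intro c a
    refine LinearMap.ext fun x => Prod.ext ?_ ?_
    · simp
    · simp [mul_smul, smul_comm c s]

theorem tri_apply (s : F) (g : M₀ →ₗ[F] A) (φ : M₀ →ₗ[F] F) (u : M₀) (x : A × A) :
    tri s g φ u x = (g u * x.1, φ u • x.1 + s • (g u * x.2)) := rfl

theorem exists_der (t : F) (φ : M₀ →ₗ[F] F) (ψ : M₁ →ₗ[F] F)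
    (h : (t = -1 ∧ ψ = 0) ∨ (t = 1 ∧ φ = 0)) :
    ∃ D : A →ₗ[F] A, D 1 = 0 ∧
      (∀ u x, D (S.gE u * x) = φ u • x - S.gE u * D x) ∧
      (∀ v x, D (S.gO v * x) = ψ v • x + t • (S.gO v * D x)) := by
  obtain ⟨Φ, ΦE, ΦO⟩ := S.lift (tri (-1) S.gE φ) (tri t S.gO ψ) (by
      intro u v
      refine LinearMap.ext fun x => Prod.ext ?_ ?_
      · simp [tri_apply, ← mul_assoc, S.ee u v]
      · simp [tri_apply, ← mul_assoc, S.ee u v, mul_add]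
        abel) (by
      intro u v
      refine LinearMap.ext fun x => Prod.ext ?_ ?_
      · simp [tri_apply, ← mul_assoc, S.eo u v]
      · rcases h with ⟨rfl, rfl⟩ | ⟨rfl, rfl⟩ <;>
        simp [tri_apply, mul_add, ← mul_assoc, S.eo u v] <;> abel) (by
      intro u v
      refine LinearMap.ext fun x => Prod.ext ?_ ?_
      · simp [tri_apply, ← mul_assoc, S.oo u v]
      · rcases h with ⟨rfl, rfl⟩ | ⟨rfl, rfl⟩
        · simp [tri_apply, ← mul_assoc, S.oo u v]
        · simp [tri_apply, mul_add, ← mul_assoc, S.oo u v]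
          abel)
  have key : ∀ x y, (Φ x y).1 = x * y.1 := by
    intro x
    have hx : x ∈ Algebra.adjoin F (Set.range S.gE ∪ Set.range S.gO) := by rw [S.adj]; trivial
    induction hx using Algebra.adjoin_induction with
    | mem x hx =>
      rcases hx with ⟨u, rfl⟩ | ⟨u, rfl⟩
      · intro y; rw [ΦE]; rfl
      · intro y; rw [ΦO]; rfl
    | algebraMap r => intro y; simp [Algebra.smul_def]
    | mul a b _ _ ha hb => intro y; simp only [map_mul, Module.End.mul_apply, ha, hb, mul_assoc]
    | add a b _ _ ha hb =>
      intro y; simp only [map_add, LinearMap.add_apply, Prod.fst_add, ha, hb, add_mul]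
  refine ⟨LinearMap.snd F _ _ ∘ₗ LinearMap.applyₗ (1, 0) ∘ₗ Φ.toLinearMap, ?_, ?_, ?_⟩
  · simp
  · intro u x
    simp [ΦE, tri_apply, key, sub_eq_add_neg]
  · intro u x
    simp [ΦO, tri_apply, key]

/-- The derivation dual to an even generator. -/
def dE (i : Fin n) : A →ₗ[F] A :=
  (S.exists_der (-1) (S.φ i) 0 (Or.inl ⟨rfl, rfl⟩)).choose

/-- The derivation dual to an odd functional. -/
def dO (ψ : M₁ →ₗ[F] F) : A →ₗ[F] A :=
  (S.exists_der 1 0 ψ (Or.inr ⟨rfl, rfl⟩)).choose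

theorem dE_one (i : Fin n) : S.dE i 1 = 0 :=
  (S.exists_der (-1) (S.φ i) 0 (Or.inl ⟨rfl, rfl⟩)).choose_spec.1

theorem dE_E (i : Fin n) (u x) : S.dE i (S.gE u * x) = S.φ i u • x - S.gE u * S.dE i x :=
  (S.exists_der (-1) (S.φ i) 0 (Or.inl ⟨rfl, rfl⟩)).choose_spec.2.1 u x

theorem dE_O (i : Fin n) (v x) : S.dE i (S.gO v * x) = - (S.gO v * S.dE i x) := by
  have := (S.exists_der (-1) (S.φ i) 0 (Or.inl ⟨rfl, rfl⟩)).choose_spec.2.2 v x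
  exact this.trans (by rw [LinearMap.zero_apply, zero_smul, zero_add, neg_one_smul]; rfl)

theorem dO_one (ψ : M₁ →ₗ[F] F) : S.dO ψ 1 = 0 :=
  (S.exists_der 1 0 ψ (Or.inr ⟨rfl, rfl⟩)).choose_spec.1

theorem dO_E (ψ : M₁ →ₗ[F] F) (u x) : S.dO ψ (S.gE u * x) = - (S.gE u * S.dO ψ x) := by
  have := (S.exists_der 1 0 ψ (Or.inr ⟨rfl, rfl⟩)).choose_spec.2.1 u x
  exact this.trans (by rw [LinearMap.zero_apply, zero_smul, zero_sub]; rfl)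

theorem dO_O (ψ : M₁ →ₗ[F] F) (v x) : S.dO ψ (S.gO v * x) = ψ v • x + S.gO v * S.dO ψ x := by
  have := (S.exists_der 1 0 ψ (Or.inr ⟨rfl, rfl⟩)).choose_spec.2.2 v x
  exact this.trans (by rw [one_smul]; rfl)

/-- monomials -/
def mn (l : List (M₀ ⊕ M₁)) : A := (l.map (Sum.elim S.gE S.gO)).prod

theorem mn_nil : S.mn [] = 1 := rfl

theorem mn_inl (u : M₀) (l) : S.mn (Sum.inl u :: l) = S.gE u * S.mn l := by simp [mn]

theorem mn_inr (u : M₁) (l) : S.mn (Sum.inr u :: l) = S.gO u * S.mn l := by simp [mn]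

theorem mn_append (l m) : S.mn (l ++ m) = S.mn l * S.mn m := by simp [mn]

/-- no central functional occurs -/
def NoZ (l : List (M₀ ⊕ M₁)) : Prop := ∀ h, Sum.inr h ∈ l → S.ζ h = 0

/-- tau -/
def τ : A := ∑ i, S.gO (S.o i) * S.gE (S.e i)

/-- degree q part -/
def HH (q : ℕ) : Submodule F A :=
  Submodule.span F {x | ∃ l : List (M₀ ⊕ M₁), l.length = q ∧ S.NoZ l ∧ x = S.mn l}

/-- number of even letters -/
def cE (l : List (M₀ ⊕ M₁)) : ℕ := l.countP Sum.isLeft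

/-- number of odd letters -/
def cO (l : List (M₀ ⊕ M₁)) : ℕ := l.countP Sum.isRight

theorem cE_inl (u) (l : List (M₀ ⊕ M₁)) : cE (Sum.inl u :: l) = cE l + 1 :=
  List.countP_cons_of_pos rfl

theorem cE_inr (u) (l : List (M₀ ⊕ M₁)) : cE (Sum.inr u :: l) = cE l :=
  List.countP_cons_of_neg (by simp)

theorem cO_inr (u) (l : List (M₀ ⊕ M₁)) : cO (Sum.inr u :: l) = cO l + 1 :=
  List.countP_cons_of_pos rfl

theorem cO_inl (u) (l : List (M₀ ⊕ M₁)) : cO (Sum.inl u :: l) = cO l :=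
  List.countP_cons_of_neg (by simp)

theorem cE_add_cO (l : List (M₀ ⊕ M₁)) : cE l + cO l = l.length := by
  induction l with
  | nil => rfl
  | cons a l ih =>
    rcases a with u | v
    · rw [cE_inl, cO_inl, List.length_cons, ← ih]; omega
    · rw [cE_inr, cO_inr, List.length_cons, ← ih]; omega

/-- bidegree (a, b) part -/
def BB (a b : ℕ) : Submodule F A :=
  Submodule.span F {x | ∃ l : List (M₀ ⊕ M₁), cE l = a ∧ cO l = b ∧ S.NoZ l ∧ x = S.mn l}

theorem E_mn (l) : ∑ i, S.gE (S.e i) * S.dE i (S.mn l) = (cE l : F) • S.mn l := by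
  induction l with
  | nil => simp [mn_nil, dE_one, cE]
  | cons a l ih =>
    rcases a with u | v
    · have h1 : ∑ i, S.φ i u • S.gE (S.e i) = S.gE u := by
        conv_rhs => rw [← S.sumE u]
        simp
      have h2 : ∀ i, S.gE (S.e i) * S.dE i (S.gE u * S.mn l) =
          (S.φ i u • S.gE (S.e i)) * S.mn l + S.gE u * (S.gE (S.e i) * S.dE i (S.mn l)) := by
        intro i
        rw [dE_E, mul_sub, ← mul_assoc, S.ee (S.e i) u]
        simp [mul_assoc]
      simp only [mn_inl, h2, Finset.sum_add_distrib, ← Finset.sum_mul, ← Finset.mul_sum, h1, ih]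
      simp [cE_inl, add_smul, add_comm]
    · have h2 : ∀ i, S.gE (S.e i) * S.dE i (S.gO v * S.mn l) =
          S.gO v * (S.gE (S.e i) * S.dE i (S.mn l)) := by
        intro i
        rw [dE_O, mul_neg, ← mul_assoc, S.eo (S.e i) v]
        simp [mul_assoc]
      simp only [mn_inr, h2, ← Finset.mul_sum, ih]
      simp [cE_inr]

theorem NoZ.tail {S : SData F M₀ M₁ A n} {a} {l} (h : S.NoZ (a :: l)) : S.NoZ l :=
  fun x hx => h x (List.mem_cons_of_mem _ hx)

theorem O_mn (l) (hl : S.NoZ l) :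
    ∑ i, S.gO (S.o i) * S.dO (S.ψ i) (S.mn l) = (cO l : F) • S.mn l := by
  induction l with
  | nil => simp [mn_nil, dO_one, cO]
  | cons a l ih =>
    have ih := ih hl.tail
    rcases a with u | v
    · have h2 : ∀ i, S.gO (S.o i) * S.dO (S.ψ i) (S.gE u * S.mn l) =
          S.gE u * (S.gO (S.o i) * S.dO (S.ψ i) (S.mn l)) := by
        intro i
        rw [dO_E, ← mul_assoc (S.gE u), S.eo u]
        simp [mul_assoc]
      simp only [mn_inl, h2, ← Finset.mul_sum, ih]
      simp [cO_inl]
    · have h1 : ∑ i, S.ψ i v • S.gO (S.o i) = S.gO v := by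
        conv_rhs => rw [← S.sumO v (hl v (by simp))]
        simp
      have h2 : ∀ i, S.gO (S.o i) * S.dO (S.ψ i) (S.gO v * S.mn l) =
          (S.ψ i v • S.gO (S.o i)) * S.mn l + S.gO v * (S.gO (S.o i) * S.dO (S.ψ i) (S.mn l)) := by
        intro i
        rw [dO_O, mul_add, ← mul_assoc, S.oo (S.o i) v]
        simp [mul_assoc]
      simp only [mn_inr, h2, Finset.sum_add_distrib, ← Finset.sum_mul, ← Finset.mul_sum, h1, ih]
      simp [cO_inr, add_smul, add_comm]

/-- The homotopy operator. -/
def hom (x : A) : A := ∑ i, S.dE i (S.dO (S.ψ i) x)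

theorem hom_E (u x) : S.hom (S.gE u * x) =
    S.gE u * S.hom x - ∑ i, S.φ i u • S.dO (S.ψ i) x := by
  simp only [hom, dO_E, map_neg, dE_E, Finset.mul_sum, ← Finset.sum_sub_distrib]
  refine Finset.sum_congr rfl fun i _ => ?_
  abel

theorem hom_O (v x) : S.hom (S.gO v * x) =
    ∑ i, S.ψ i v • S.dE i x - S.gO v * S.hom x := by
  simp only [hom, dO_O, map_add, map_smul, dE_O, Finset.mul_sum, ← Finset.sum_sub_distrib]
  refine Finset.sum_congr rfl fun i _ => ?_
  abel

theorem hom_τ (x : A) : S.hom (S.τ * x) = (n : F) • x - ∑ i, S.gE (S.e i) * S.dE i x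
    + ∑ i, S.gO (S.o i) * S.dO (S.ψ i) x - S.τ * S.hom x := by
  have hadd : S.hom (S.τ * x) = ∑ j, S.hom (S.gO (S.o j) * (S.gE (S.e j) * x)) := by
    simp only [hom, τ, Finset.sum_mul, map_sum, mul_assoc]
    rw [Finset.sum_comm]
  have h : ∀ j, S.hom (S.gO (S.o j) * (S.gE (S.e j) * x)) =
      x - S.gE (S.e j) * S.dE j x + S.gO (S.o j) * S.dO (S.ψ j) x
        - S.gO (S.o j) * S.gE (S.e j) * S.hom x := by
    intro j
    rw [hom_O, hom_E]
    simp only [S.ψo, S.φe, ite_smul, one_smul, zero_smul, Finset.sum_ite_eq', Finset.mem_univ,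
      if_true, dE_E, mul_sub, mul_assoc]
    abel
  rw [hadd]
  simp only [h, Finset.sum_sub_distrib, Finset.sum_add_distrib, τ, Finset.sum_mul]
  simp [Nat.cast_smul_eq_nsmul]

theorem τ_E (u) : S.τ * S.gE u = S.gE u * S.τ := by
  simp only [τ, Finset.sum_mul, Finset.mul_sum]
  refine Finset.sum_congr rfl fun i _ => ?_
  rw [mul_assoc, S.ee, ← mul_assoc (S.gE u), S.eo]
  simp [mul_assoc]

theorem τ_O (u) : S.τ * S.gO u = -(S.gO u * S.τ) := by
  simp only [τ, Finset.sum_mul, Finset.mul_sum, ← Finset.sum_neg_distrib]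
  refine Finset.sum_congr rfl fun i _ => ?_
  rw [mul_assoc, S.eo, ← mul_assoc (S.gO u), S.oo u]
  simp [mul_assoc]

theorem τ_mn (l) : S.τ * S.mn l = (-1 : F) ^ cO l • (S.mn l * S.τ) := by
  induction l with
  | nil => simp [mn_nil, cO]
  | cons a l ih =>
    rcases a with u | v
    · rw [mn_inl, ← mul_assoc, τ_E, mul_assoc, ih]
      simp [cO_inl, mul_assoc]
    · rw [mn_inr, ← mul_assoc, τ_O, neg_mul, mul_assoc, ih]
      simp [cO_inr, mul_assoc, pow_succ]

theorem τ_BB {a b : ℕ} {x : A} (hx : x ∈ S.BB a b) : S.τ * x = (-1 : F) ^ b • (x * S.τ) := by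
  induction hx using Submodule.span_induction with
  | mem x h => obtain ⟨l, -, rfl, -, rfl⟩ := h; exact S.τ_mn l
  | zero => simp
  | add x y _ _ hx hy => simp [mul_add, add_mul, hx, hy]
  | smul c x _ hx => simp [hx, smul_comm c]

theorem τ_HH {q : ℕ} {x : A} (hx : x ∈ S.HH q) : ∃ y ∈ S.HH q, S.τ * x = y * S.τ := by
  induction hx using Submodule.span_induction with
  | mem x h =>
    obtain ⟨l, h1, h2, rfl⟩ := h
    refine ⟨(-1 : F) ^ cO l • S.mn l, Submodule.smul_mem _ _ (Submodule.subset_span ⟨l, h1, h2, rfl⟩), ?_⟩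
    rw [τ_mn]; simp
  | zero => exact ⟨0, zero_mem _, by simp⟩
  | add x y _ _ hx hy =>
    obtain ⟨x', h1, h2⟩ := hx
    obtain ⟨y', h3, h4⟩ := hy
    exact ⟨x' + y', add_mem h1 h3, by rw [mul_add, add_mul, h2, h4]⟩
  | smul c x _ hx =>
    obtain ⟨x', h1, h2⟩ := hx
    exact ⟨c • x', Submodule.smul_mem _ _ h1, by simp [h2]⟩

theorem hom_BB {a b : ℕ} {x : A} (hx : x ∈ S.BB a b) (h0 : S.τ * x = 0) :
    ((n : F) - a + b) • x = S.τ * S.hom x := by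
  have hE : ∑ i, S.gE (S.e i) * S.dE i x = (a : F) • x := by
    clear h0
    induction hx using Submodule.span_induction with
    | mem x h => obtain ⟨l, rfl, -, -, rfl⟩ := h; exact S.E_mn l
    | zero => simp
    | add x y _ _ hx hy => simp [mul_add, Finset.sum_add_distrib, hx, hy]
    | smul c x _ hx => simp [← Finset.smul_sum, hx, smul_comm c]
  have hO : ∑ i, S.gO (S.o i) * S.dO (S.ψ i) x = (b : F) • x := by
    clear h0 hE
    induction hx using Submodule.span_induction with
    | mem x h => obtain ⟨l, -, rfl, h, rfl⟩ := h; exact S.O_mn l h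
    | zero => simp
    | add x y _ _ hx hy => simp [mul_add, Finset.sum_add_distrib, hx, hy]
    | smul c x _ hx => simp [← Finset.smul_sum, hx, smul_comm c]
  have := S.hom_τ x
  rw [h0, hE, hO] at this
  have h1 : S.hom 0 = 0 := by simp [hom]
  rw [h1] at this
  rw [add_smul, sub_smul]
  exact sub_eq_zero.1 this.symm

theorem E_mul_HH {k : ℕ} (u : M₀) {x : A} (hx : x ∈ S.HH k) : S.gE u * x ∈ S.HH (k + 1) := by
  induction hx using Submodule.span_induction with
  | mem x h =>
    obtain ⟨l, h1, h2, rfl⟩ := h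
    refine Submodule.subset_span ⟨Sum.inl u :: l, by simp [h1], ?_, (S.mn_inl u l).symm⟩
    intro h hh
    exact h2 h (by simpa using hh)
  | zero => simp
  | add x y _ _ hx hy => rw [mul_add]; exact add_mem hx hy
  | smul c x _ hx => rw [mul_smul_comm]; exact Submodule.smul_mem _ _ hx

theorem O_mul_HH {k : ℕ} (u : M₁) (hu : S.ζ u = 0) {x : A} (hx : x ∈ S.HH k) :
    S.gO u * x ∈ S.HH (k + 1) := by
  induction hx using Submodule.span_induction with
  | mem x h =>
    obtain ⟨l, h1, h2, rfl⟩ := h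
    refine Submodule.subset_span ⟨Sum.inr u :: l, by simp [h1], ?_, (S.mn_inr u l).symm⟩
    intro h hh
    rcases List.mem_cons.1 hh with hh | hh
    · rw [Sum.inr.inj hh, hu]
    · exact h2 h hh
  | zero => simp
  | add x y _ _ hx hy => rw [mul_add]; exact add_mem hx hy
  | smul c x _ hx => rw [mul_smul_comm]; exact Submodule.smul_mem _ _ hx

theorem der_HH_zero (D : A →ₗ[F] A) (h1 : D 1 = 0) {x : A} (hx : x ∈ S.HH 0) : D x = 0 := by
  induction hx using Submodule.span_induction with
  | mem x h =>
    obtain ⟨l, hl, -, rfl⟩ := h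
    rw [List.length_eq_zero_iff.1 hl, mn_nil, h1]
  | zero => simp
  | add x y _ _ hx hy => rw [map_add, hx, hy, add_zero]
  | smul c x _ hx => rw [map_smul, hx, smul_zero]

theorem der_HH (D : A →ₗ[F] A) (h1 : D 1 = 0)
    (hE : ∀ u x, ∃ c s : F, D (S.gE u * x) = c • x + s • (S.gE u * D x))
    (hO : ∀ u x, ∃ c s : F, D (S.gO u * x) = c • x + s • (S.gO u * D x))
    (k : ℕ) {x : A} (hx : x ∈ S.HH (k + 1)) : D x ∈ S.HH k := by
  have key : ∀ (k : ℕ) (l : List (M₀ ⊕ M₁)), l.length = k + 1 → S.NoZ l →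
      D (S.mn l) ∈ S.HH k := by
    intro k
    induction k with
    | zero =>
      intro l hl hz
      obtain ⟨a, rfl⟩ := List.length_eq_one_iff.1 hl
      have hone : (1 : A) ∈ S.HH 0 := Submodule.subset_span ⟨[], rfl, by simp [NoZ], rfl⟩
      rcases a with u | v
      · obtain ⟨c, s, h⟩ := hE u 1
        rw [mn_inl, mn_nil, h, h1, mul_zero, smul_zero, add_zero]
        exact Submodule.smul_mem _ _ hone
      · obtain ⟨c, s, h⟩ := hO v 1
        rw [mn_inr, mn_nil, h, h1, mul_zero, smul_zero, add_zero]
        exact Submodule.smul_mem _ _ hone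
    | succ k ih =>
      intro l hl hz
      rcases l with _ | ⟨a, l⟩
      · simp at hl
      have hl' : l.length = k + 1 := by simpa using hl
      have hm : S.mn l ∈ S.HH (k + 1) := Submodule.subset_span ⟨l, hl', hz.tail, rfl⟩
      have hd := ih l hl' hz.tail
      rcases a with u | v
      · obtain ⟨c, s, h⟩ := hE u (S.mn l)
        rw [mn_inl, h]
        exact add_mem (Submodule.smul_mem _ _ hm) (Submodule.smul_mem _ _ (S.E_mul_HH u hd))
      · obtain ⟨c, s, h⟩ := hO v (S.mn l)
        rw [mn_inr, h]
        exact add_mem (Submodule.smul_mem _ _ hm)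
          (Submodule.smul_mem _ _ (S.O_mul_HH v (hz v (by simp)) hd))
  induction hx using Submodule.span_induction with
  | mem x h =>
    obtain ⟨l, hl, hz, rfl⟩ := h
    exact key k l hl hz
  | zero => simp
  | add x y _ _ hx hy => rw [map_add]; exact add_mem hx hy
  | smul c x _ hx => rw [map_smul]; exact Submodule.smul_mem _ _ hx

theorem dE_HH (i) (k : ℕ) {x : A} (hx : x ∈ S.HH (k + 1)) : S.dE i x ∈ S.HH k :=
  S.der_HH (S.dE i) (S.dE_one i)
    (fun u x => ⟨S.φ i u, -1, by rw [dE_E]; simp [sub_eq_add_neg]⟩)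
    (fun u x => ⟨0, -1, by rw [dE_O]; simp⟩) k hx

theorem dO_HH (ψ) (k : ℕ) {x : A} (hx : x ∈ S.HH (k + 1)) : S.dO ψ x ∈ S.HH k :=
  S.der_HH (S.dO ψ) (S.dO_one ψ)
    (fun u x => ⟨0, -1, by rw [dO_E]; simp⟩)
    (fun u x => ⟨ψ u, 1, by rw [dO_O]; simp⟩) k hx

theorem hom_HH {q : ℕ} {x : A} (hx : x ∈ S.HH q) : S.hom x ∈ S.HH (q - 2) := by
  refine Submodule.sum_mem _ fun i _ => ?_
  rcases q with _ | _ | q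
  · rw [S.der_HH_zero _ (S.dO_one _) hx]; simp
  · rw [S.der_HH_zero _ (S.dE_one _) (S.dO_HH _ 0 hx)]; simp
  · exact S.dE_HH i q (S.dO_HH _ _ hx)

theorem BB_le_HH (a b : ℕ) : S.BB a b ≤ S.HH (a + b) := by
  refine Submodule.span_mono ?_
  rintro x ⟨l, rfl, rfl, h, rfl⟩
  exact ⟨l, (cE_add_cO l).symm, h, rfl⟩

theorem HH_decomp {q : ℕ} {x : A} (hx : x ∈ S.HH q) :
    ∃ f : ℕ → A, (∀ a ∈ Finset.range (q + 1), f a ∈ S.BB a (q - a)) ∧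
      x = ∑ a ∈ Finset.range (q + 1), f a := by
  induction hx using Submodule.span_induction with
  | mem x h =>
    obtain ⟨l, hl, hz, rfl⟩ := h
    have h := cE_add_cO l
    refine ⟨fun a => if a = cE l then S.mn l else 0, ?_, ?_⟩
    · intro a _
      dsimp only
      split_ifs with h'
      · exact Submodule.subset_span ⟨l, h'.symm, by omega, hz, rfl⟩
      · exact zero_mem _
    · rw [Finset.sum_ite_eq', if_pos]
      rw [Finset.mem_range]; omega
  | zero => exact ⟨0, fun _ _ => zero_mem _, by simp⟩
  | add x y _ _ hx hy =>
    obtain ⟨f, hf, rfl⟩ := hx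
    obtain ⟨g, hg, rfl⟩ := hy
    exact ⟨f + g, fun a ha => add_mem (hf a ha) (hg a ha), by simp [Finset.sum_add_distrib]⟩
  | smul c x _ hx =>
    obtain ⟨f, hf, rfl⟩ := hx
    exact ⟨c • f, fun a ha => Submodule.smul_mem _ _ (hf a ha), by simp [Finset.smul_sum]⟩

/-- The even number operator. -/
def opE : Module.End F A := ∑ i, LinearMap.mulLeft F (S.gE (S.e i)) ∘ₗ S.dE i

theorem opE_mn (l) : S.opE (S.mn l) = (cE l : F) • S.mn l := by
  rw [← E_mn]; simp [opE]

theorem mn_replicate (m : ℕ) : S.mn (List.replicate m (Sum.inr S.z)) = S.gO S.z ^ m := by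
  simp [mn]

theorem opE_BB {a b : ℕ} {x : A} (hx : x ∈ S.BB a b) (m : ℕ) :
    S.opE (x * (S.τ * S.gO S.z ^ m)) = ((a + 1 : ℕ) : F) • (x * (S.τ * S.gO S.z ^ m)) := by
  induction hx using Submodule.span_induction with
  | mem x h =>
    obtain ⟨l, rfl, -, -, rfl⟩ := h
    simp only [τ, Finset.sum_mul, Finset.mul_sum, map_sum, Finset.smul_sum]
    refine Finset.sum_congr rfl fun i _ => ?_
    have h1 : S.mn l * (S.gO (S.o i) * S.gE (S.e i) * S.gO S.z ^ m) =
        S.mn (l ++ (Sum.inr (S.o i) :: Sum.inl (S.e i) :: List.replicate m (Sum.inr S.z))) := by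
      rw [mn_append, mn_inr, mn_inl, mn_replicate, mul_assoc (S.gO (S.o i))]
    rw [h1, opE_mn]
    congr 2
    have h2 : cE (List.replicate m (Sum.inr S.z : M₀ ⊕ M₁)) = 0 := by
      simp [cE, List.countP_replicate]
    have h3 : ∀ l m : List (M₀ ⊕ M₁), cE (l ++ m) = cE l + cE m := fun l m => List.countP_append
    rw [h3, cE_inr, cE_inl, h2]
  | zero => simp
  | add x y _ _ hx hy => rw [add_mul, map_add, hx, hy, smul_add]
  | smul c x _ hx => rw [smul_mul_assoc, map_smul, hx, smul_comm]

theorem dz_mn (l) (hl : S.NoZ l) (y : A) :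
    S.dO S.ζ (S.mn l * y) = (-1 : F) ^ cE l • (S.mn l * S.dO S.ζ y) := by
  induction l with
  | nil => simp [mn_nil, cE]
  | cons a l ih =>
    have ih := ih hl.tail
    rcases a with u | v
    · rw [mn_inl, mul_assoc, dO_E, ih, cE_inl, pow_succ]
      simp [mul_assoc]
    · rw [mn_inr, mul_assoc, dO_O, ih, cE_inr, hl v (by simp)]
      simp [mul_assoc]

theorem dz_τ (y : A) : S.dO S.ζ (S.τ * y) = - (S.τ * S.dO S.ζ y) := by
  simp only [τ, Finset.sum_mul, map_sum, ← Finset.sum_neg_distrib, mul_assoc, dO_O, dO_E, S.ζo]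
  simp

theorem dz_pow (m : ℕ) : S.dO S.ζ (S.gO S.z ^ (m + 1)) = ((m + 1 : ℕ) : F) • S.gO S.z ^ m := by
  induction m with
  | zero =>
    have := S.dO_O S.ζ S.z 1
    simpa [dO_one, S.ζz] using this
  | succ m ih =>
    rw [pow_succ', dO_O, ih, S.ζz, mul_smul_comm, ← pow_succ']
    push_cast
    simp only [add_smul, one_smul]
    abel

theorem dz_BB {a b : ℕ} {x : A} (hx : x ∈ S.BB a b) (y : A) :
    S.dO S.ζ (x * y) = (-1 : F) ^ a • (x * S.dO S.ζ y) := by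
  induction hx using Submodule.span_induction with
  | mem x h => obtain ⟨l, rfl, -, h, rfl⟩ := h; exact S.dz_mn l h y
  | zero => simp
  | add x y _ _ hx hy => rw [add_mul, map_add, hx, hy, add_mul, smul_add]
  | smul c x _ hx => rw [smul_mul_assoc, map_smul, hx, smul_comm, smul_mul_assoc]

theorem cancel_z [CharZero F] {a b : ℕ} {x : A} (hx : x ∈ S.BB a b) (m : ℕ)
    (h : x * (S.τ * S.gO S.z ^ m) = 0) : x * S.τ = 0 := by
  induction m with
  | zero => simpa using h
  | succ m ih =>
    apply ih
    have h2 := S.dz_BB hx (S.τ * S.gO S.z ^ (m + 1))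
    rw [h, map_zero, dz_τ, dz_pow] at h2
    have h3 : (-1 : F) ^ a • ((m + 1 : ℕ) : F) • (x * (S.τ * S.gO S.z ^ m)) = 0 := by
      simpa using h2
    rcases smul_eq_zero.1 h3 with h4 | h4
    · simp at h4
    · rcases smul_eq_zero.1 h4 with h5 | h5
      · exact absurd h5 (by exact_mod_cast Nat.succ_ne_zero m)
      · exact h5

theorem O_mn_inl (v : M₁) (le : List M₀) : S.gO v * S.mn (le.map Sum.inl) =
    (-1 : F) ^ le.length • (S.mn (le.map Sum.inl) * S.gO v) := by
  induction le with
  | nil => simp [mn_nil]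
  | cons u l ih =>
    rw [List.map_cons, mn_inl, ← mul_assoc, ← neg_neg (S.gO v * S.gE u), ← S.eo, neg_mul, mul_assoc,
      ih, List.length_cons, pow_succ]
    simp [mul_assoc]

theorem mn_sort (l : List (M₀ ⊕ M₁)) : ∃ (s : F) (le : List M₀) (lo : List M₁),
    le.length = cE l ∧ lo.length = cO l ∧
      S.mn l = s • (S.mn (le.map Sum.inl) * S.mn (lo.map Sum.inr)) := by
  induction l with
  | nil => exact ⟨1, [], [], rfl, rfl, by simp [mn_nil]⟩
  | cons a l ih =>
    obtain ⟨s, le, lo, h1, h2, h3⟩ := ih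
    rcases a with u | v
    · refine ⟨s, u :: le, lo, by simp [h1, cE_inl], by simp [h2, cO_inl], ?_⟩
      rw [mn_inl, h3, List.map_cons, mn_inl]
      simp [mul_assoc]
    · refine ⟨s * (-1) ^ le.length, le, v :: lo, by simp [h1, cE_inr], by simp [h2, cO_inr], ?_⟩
      rw [mn_inr, h3, List.map_cons, mn_inr, mul_smul_comm, ← mul_assoc, O_mn_inl]
      simp [mul_assoc, mul_smul]

theorem exists_alt [CharZero F] (k : ℕ) : ∃ f : M₀ [⋀^Fin k]→ₗ[F] A,
    ∀ v : Fin k → M₀, f v = S.mn ((List.ofFn v).map Sum.inl) := by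
  have hsq : ∀ u, S.gE u * S.gE u = 0 := by
    intro u
    have h := S.ee u u
    have h2 : (2 : F) • (S.gE u * S.gE u) = 0 := by
      rw [two_smul]; nth_rewrite 1 [h]; simp
    rcases smul_eq_zero.1 h2 with h3 | h3
    · exact absurd h3 two_ne_zero
    · exact h3
  refine ⟨(ExteriorAlgebra.lift F ⟨S.gE, hsq⟩).toLinearMap.compAlternatingMap
    (ExteriorAlgebra.ιMulti F k), fun v => ?_⟩
  simp [ExteriorAlgebra.ιMulti_apply, mn, map_list_prod, List.map_ofFn, Function.comp_def]

theorem e_span : ⊤ ≤ Submodule.span F (Set.range S.e) := by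
  intro u _
  rw [← S.sumE u]
  exact Submodule.sum_mem _ fun i _ => Submodule.smul_mem _ _ (Submodule.subset_span ⟨i, rfl⟩)

theorem e_indep : LinearIndependent F S.e := by
  rw [Fintype.linearIndependent_iff]
  intro g hg i
  have := congrArg (S.φ i) hg
  simpa [S.φe] using this

/-- The basis `e`. -/
def bas : Module.Basis (Fin n) F M₀ := Module.Basis.mk S.e_indep S.e_span

theorem mn_big [CharZero F] (le : List M₀) (h : n < le.length) :
    S.mn (le.map Sum.inl) = 0 := by
  obtain ⟨f, hf⟩ := S.exists_alt le.length
  have h1 := hf le.get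
  rw [List.ofFn_get] at h1
  rw [← h1]
  apply f.map_linearDependent
  intro hli
  have := Module.Finite.of_basis S.bas
  have h2 := hli.fintype_card_le_finrank
  rw [Module.finrank_eq_card_basis S.bas] at h2
  simp at h2
  omega

theorem mn_top [CharZero F] (le : List M₀) (h : le.length = n) :
    ∃ c : F, S.mn (le.map Sum.inl) = c • S.mn ((List.ofFn S.e).map Sum.inl) := by
  obtain ⟨f, hf⟩ := S.exists_alt n
  subst h
  have h1 := hf le.get
  rw [List.ofFn_get] at h1
  rw [← h1, ← hf S.e]
  have hb : (S.bas : Fin le.length → M₀) = S.e := by simp [bas]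
  have h3 : S.bas.det S.e = 1 := by rw [← hb]; exact S.bas.det_self
  have h4 : f = (LinearMap.toSpanSingleton F A (f S.e)).compAlternatingMap S.bas.det := by
    refine Module.Basis.ext_alternating S.bas fun v hv => ?_
    let σ : Equiv.Perm (Fin le.length) := Equiv.ofBijective v (Finite.injective_iff_bijective.1 hv)
    have h5 : (fun i => S.bas (v i)) = fun i => S.e (σ i) := by
      funext i
      rw [hb]
      rfl
    have h6 : f (fun i => S.e (σ i)) = Equiv.Perm.sign σ • f S.e := f.map_perm S.e σ
    have h7 : S.bas.det (fun i => S.e (σ i)) = Equiv.Perm.sign σ • S.bas.det S.e :=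
      S.bas.det.map_perm S.e σ
    rw [h5, h6, LinearMap.compAlternatingMap_apply, h7, h3, LinearMap.toSpanSingleton_apply]
    rcases Int.units_eq_one_or (Equiv.Perm.sign σ) with h | h <;> rw [h] <;> simp
  refine ⟨S.bas.det le.get, ?_⟩
  have h8 := congrArg (fun g => g le.get) h4
  exact h8

theorem BB_top [CharZero F] {a b : ℕ} {x : A} (hx : x ∈ S.BB a b) (hab : a = n + b) :
    ∃ c : F, x = (if a + b = n then c else 0) • S.mn ((List.ofFn S.e).map Sum.inl) := by
  induction hx using Submodule.span_induction with
  | mem x h =>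
    obtain ⟨l, h1, h2, -, rfl⟩ := h
    obtain ⟨s, le, lo, h3, h4, h5⟩ := S.mn_sort l
    by_cases hb : b = 0
    · have hlo : lo = [] := List.length_eq_zero_iff.1 (by omega)
      obtain ⟨c, hc⟩ := S.mn_top le (by omega)
      refine ⟨s * c, ?_⟩
      rw [if_pos (by omega), h5, hlo, hc]
      simp [mn_nil, mul_smul]
    · refine ⟨0, ?_⟩
      rw [h5, S.mn_big le (by omega)]
      simp
  | zero => exact ⟨0, by simp⟩
  | add x y _ _ hx hy =>
    obtain ⟨c, h1⟩ := hx
    obtain ⟨d, h2⟩ := hy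
    refine ⟨c + d, ?_⟩
    rw [h1, h2, ← add_smul]
    split_ifs <;> simp
  | smul r x _ hx =>
    obtain ⟨c, h1⟩ := hx
    refine ⟨r * c, ?_⟩
    rw [h1, ← mul_smul]
    split_ifs <;> simp

theorem main_BB [CharZero F] {q a b : ℕ} (hq : a + b = q) {x : A} (hx : x ∈ S.BB a b)
    (h0 : x * S.τ = 0) :
    ∃ β ∈ S.HH (q - 2), ∃ c : F,
      x = β * S.τ + (if q = n then c else 0) • S.mn ((List.ofFn S.e).map Sum.inl) := by
  subst hq
  by_cases hab : a = n + b
  · obtain ⟨c, hc⟩ := S.BB_top hx hab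
    exact ⟨0, zero_mem _, c, by simpa using hc⟩
  · have hne : (n : F) - a + b ≠ 0 := by
      intro h
      apply hab
      have : (a : F) = ((n + b : ℕ) : F) := by push_cast; linear_combination -h
      exact_mod_cast this
    have h1 : S.τ * x = 0 := by rw [S.τ_BB hx, h0, smul_zero]
    obtain ⟨y, hy, hy2⟩ := S.τ_HH (S.hom_HH (S.BB_le_HH a b hx))
    refine ⟨((n : F) - a + b)⁻¹ • y, Submodule.smul_mem _ _ hy, 0, ?_⟩
    have h2 := S.hom_BB hx h1
    rw [hy2] at h2
    rw [smul_mul_assoc, ← h2, smul_smul, inv_mul_cancel₀ hne]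
    simp

theorem main [CharZero F] {q m : ℕ} {x : A} (hx : x ∈ S.HH q)
    (h0 : x * (S.τ * S.gO S.z ^ m) = 0) :
    ∃ β ∈ S.HH (q - 2), ∃ c : F,
      x = β * S.τ + (if q = n then c else 0) • S.mn ((List.ofFn S.e).map Sum.inl) := by
  obtain ⟨f, hf, rfl⟩ := S.HH_decomp hx
  have hcomp : ∀ a ∈ Finset.range (q + 1), f a * (S.τ * S.gO S.z ^ m) = 0 := by
    have hind := Module.End.eigenspaces_iSupIndep S.opE
    have hinj : Function.Injective (fun a : ℕ => ((a + 1 : ℕ) : F)) := by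
      intro a b h
      have h' : ((a + 1 : ℕ) : F) = ((b + 1 : ℕ) : F) := h
      have := Nat.cast_injective h'
      omega
    have hind2 := hind.comp hinj
    rw [Finset.sum_mul] at h0
    refine (iSupIndep_iff_finsetSum_eq_zero_imp_eq_zero _).1 hind2 _ _ ?_ h0
    intro a ha
    exact Module.End.mem_eigenspace_iff.2 (S.opE_BB (hf a ha) m)
  have hall : ∀ a ∈ Finset.range (q + 1), ∃ β ∈ S.HH (q - 2), ∃ c : F,
      f a = β * S.τ + (if q = n then c else 0) • S.mn ((List.ofFn S.e).map Sum.inl) := by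
    intro a ha
    have hle := Finset.mem_range.1 ha
    exact S.main_BB (by omega) (hf a ha) (S.cancel_z (hf a ha) m (hcomp a ha))
  clear hcomp h0 hx hf
  generalize Finset.range (q + 1) = s at hall ⊢
  induction s using Finset.induction_on with
  | empty => exact ⟨0, zero_mem _, 0, by simp⟩
  | insert a s has ih =>
    obtain ⟨β, hβ, c, h1⟩ := ih (fun b hb => hall b (Finset.mem_insert_of_mem hb))
    obtain ⟨β', hβ', c', h2⟩ := hall a (Finset.mem_insert_self _ _)
    refine ⟨β' + β, add_mem hβ' hβ, c' + c, ?_⟩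
    rw [Finset.sum_insert has, h1, h2, add_mul]
    split_ifs
    · rw [add_smul]; abel
    · simp

end SData
section Inst

variable (F : Type) [Field F] (M₀ M₁ : Type) [AddCommGroup M₀] [Module F M₀] [AddCommGroup M₁]
  [Module F M₁]

/-- The even generators as a linear map. -/
def gEl : M₀ →ₗ[F] SExt F M₀ M₁ :=
  (RingQuot.mkAlgHom F (SRel F M₀ M₁)).toLinearMap ∘ₗ ι F ∘ₗ LinearMap.inl F M₀ M₁

/-- The odd generators as a linear map. -/
def gOl : M₁ →ₗ[F] SExt F M₀ M₁ :=
  (RingQuot.mkAlgHom F (SRel F M₀ M₁)).toLinearMap ∘ₗ ι F ∘ₗ LinearMap.inr F M₀ M₁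

theorem gEl_ee (u v : M₀) : gEl F M₀ M₁ u * gEl F M₀ M₁ v =
    (-1 : F) • (gEl F M₀ M₁ v * gEl F M₀ M₁ u) := by
  have h := RingQuot.mkAlgHom_rel F (SRel.ee (F := F) (M₀ := M₀) (M₁ := M₁) u v)
  rw [← neg_one_smul F, map_smul, map_mul, map_mul] at h
  exact h

theorem gEl_eo (u : M₀) (v : M₁) : gEl F M₀ M₁ u * gOl F M₀ M₁ v =
    (-1 : F) • (gOl F M₀ M₁ v * gEl F M₀ M₁ u) := by
  have h := RingQuot.mkAlgHom_rel F (SRel.eo (F := F) (M₀ := M₀) (M₁ := M₁) u v)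
  rw [← neg_one_smul F, map_smul, map_mul, map_mul] at h
  exact h

theorem gOl_oo (u v : M₁) : gOl F M₀ M₁ u * gOl F M₀ M₁ v =
    gOl F M₀ M₁ v * gOl F M₀ M₁ u := by
  have h := RingQuot.mkAlgHom_rel F (SRel.oo (F := F) (M₀ := M₀) (M₁ := M₁) u v)
  rw [map_mul, map_mul] at h
  exact h

theorem g_lift {B : Type} [Ring B] [Algebra F B] (f : M₀ →ₗ[F] B) (g : M₁ →ₗ[F] B)
    (h1 : ∀ u v, f u * f v = -(f v * f u)) (h2 : ∀ u v, f u * g v = -(g v * f u))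
    (h3 : ∀ u v, g u * g v = g v * g u) :
    ∃ Φ : SExt F M₀ M₁ →ₐ[F] B, (∀ u, Φ (gEl F M₀ M₁ u) = f u) ∧
      (∀ v, Φ (gOl F M₀ M₁ v) = g v) := by
  have hrel : ∀ ⦃x y⦄, SRel F M₀ M₁ x y →
      TensorAlgebra.lift F (f.coprod g) x = TensorAlgebra.lift F (f.coprod g) y := by
    intro x y h
    cases h with
    | ee u v =>
      rw [← neg_one_smul F, map_smul, map_mul, map_mul]
      simp only [lift_ι_apply, LinearMap.coprod_apply, map_zero, add_zero, zero_add, h1 u v]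
      rw [neg_one_smul]
    | eo u v =>
      rw [← neg_one_smul F, map_smul, map_mul, map_mul]
      simp only [lift_ι_apply, LinearMap.coprod_apply, map_zero, add_zero, zero_add, h2 u v]
      rw [neg_one_smul]
    | oo u v =>
      rw [map_mul, map_mul]
      simp only [lift_ι_apply, LinearMap.coprod_apply, map_zero, zero_add, h3 u v]
  refine ⟨RingQuot.liftAlgHom F ⟨TensorAlgebra.lift F (f.coprod g), hrel⟩, ?_, ?_⟩
  · intro u
    have h := RingQuot.liftAlgHom_mkAlgHom_apply F (TensorAlgebra.lift F (f.coprod g)) hrel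
      (ι F (u, (0 : M₁)))
    refine h.trans ?_
    simp
  · intro u
    have h := RingQuot.liftAlgHom_mkAlgHom_apply F (TensorAlgebra.lift F (f.coprod g)) hrel
      (ι F ((0 : M₀), u))
    refine h.trans ?_
    simp

theorem g_adj : Algebra.adjoin F (Set.range (gEl F M₀ M₁) ∪ Set.range (gOl F M₀ M₁)) = ⊤ := by
  rw [eq_top_iff]
  intro x _
  obtain ⟨t, rfl⟩ := RingQuot.mkAlgHom_surjective F (SRel F M₀ M₁) x
  induction t using TensorAlgebra.induction with
  | algebraMap r => rw [AlgHom.commutes]; exact Subalgebra.algebraMap_mem _ r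
  | ι p =>
    have h : RingQuot.mkAlgHom F (SRel F M₀ M₁) (ι F p) =
        gEl F M₀ M₁ p.1 + gOl F M₀ M₁ p.2 := by
      have hp : p = (p.1, (0 : M₁)) + ((0 : M₀), p.2) := by simp
      conv_lhs => rw [hp, map_add, map_add]
      rfl
    rw [h]
    exact add_mem (Algebra.subset_adjoin (Or.inl ⟨_, rfl⟩))
      (Algebra.subset_adjoin (Or.inr ⟨_, rfl⟩))
  | mul a b ha hb => rw [map_mul]; exact mul_mem (ha trivial) (hb trivial)
  | add a b ha hb => rw [map_add]; exact add_mem (ha trivial) (hb trivial)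

/-- The concrete instance. -/
def kData (n : ℕ) : @SData F (Module.Dual F (KV₀ F n)) (Module.Dual F (KV₁ F n)) (KC F n) _ _ _ _ _
    (Algebra.semiringToRing F) _ n :=
  letI : Ring (KC F n) := Algebra.semiringToRing F
  { gE := gEl F _ _
    gO := gOl F _ _
    ee := gEl_ee F _ _
    eo := gEl_eo F _ _
    oo := gOl_oo F _ _
    lift := fun f g h1 h2 h3 => g_lift F _ _ f g h1 h2 h3
    adj := g_adj F _ _
    φ := fun i => LinearMap.applyₗ (Pi.single i 1)
    ψ := fun i => LinearMap.applyₗ (Pi.single i.castSucc 1)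
    ζ := LinearMap.applyₗ (Pi.single (Fin.last n) 1)
    e := fun i => LinearMap.proj i
    o := fun i => LinearMap.proj i.castSucc
    z := LinearMap.proj (Fin.last n)
    φe := by
      intro i j
      simp [Pi.single_apply, eq_comm]
    ψo := by
      intro i j
      simp [Pi.single_apply, eq_comm]
    ζo := by
      intro i
      simp [Pi.single_apply]
    ζz := by simp
    sumE := by
      intro u
      refine LinearMap.pi_ext' fun j => LinearMap.ext_ring ?_
      simp [Pi.single_apply]
    sumO := by
      intro v hv
      have hv' : v (Pi.single (Fin.last n) 1) = 0 := hv
      refine LinearMap.pi_ext' fun j => LinearMap.ext_ring ?_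
      refine Fin.lastCases ?_ (fun j => ?_) j
      · simp [Pi.single_apply, hv']
      · simp [Pi.single_apply] }

end Inst

theorem stmt9 [CharZero F] (n : ℕ) (hn : 1 ≤ n) (q l : ℕ) (hl : 1 ≤ l)
    (α : KC F n) (hα : α ∈ Hn F n q) (h0 : α * kTauL F n l = 0) :
    ∃ β ∈ Hn F n (q - 2), ∃ lam : F,
      α = β * kTau F n + (if q = n then lam else 0) • kTop F n := by
  have hl' : (l : F) ≠ 0 := by
    have : l ≠ 0 := by omega
    exact_mod_cast this
  have h1 : α * (kTau F n * kZ F n ^ (l - 1)) = 0 := by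
    rw [kTauL, mul_smul_comm] at h0
    have h2 := congrArg (fun y => (l : F)⁻¹ • y) h0
    simpa only [smul_smul, inv_mul_cancel₀ hl', one_smul, smul_zero] using h2
  have h3 := @SData.main F _ _ (KC F n) _ _ _ _ _ (Algebra.semiringToRing F) _ n (kData F n) _ q
    (l - 1) α hα h1
  obtain ⟨β, hβ, c, h4⟩ := h3
  refine ⟨β, hβ, c, ?_⟩
  rw [List.map_ofFn] at h4
  exact h4
end
end
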